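/- arXiv:1611.05256 — 2 statements merged into one kernel-verified Lean document; each statement's English description precedes it below -/
import Mathlib

section
/- Let V be a vector space over ℚ(q) and let u, v : ℕ → V be sequences such that for every n, u(n) = ∑_{k=0}^{⌊n/2⌋} q^{−k} ([n choose k]_q − [n choose k−1]_q) v(n−2k). Then for every n, v(n) = ∑_{j=0}^{⌊n/2⌋} (−1)^j q^{j(j−1)/2} [n−j choose j]_q u(n−2j). -/
open Finset

/-- The indeterminate `q`, viewed in the field `ℚ(q)` of rational functions. -/
noncomputable def q : RatFunc ℚ := RatFunc.X

/-- The Gaussian binomial coefficient `[n choose k]_q` in `ℚ(q)`. -/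
noncomputable def qbinom (n k : ℤ) : RatFunc ℚ :=
  if 0 ≤ k ∧ k ≤ n then
    ∏ i ∈ Finset.range k.toNat, (1 - q ^ (n - k + (i : ℤ) + 1)) / (1 - q ^ ((i : ℤ) + 1))
  else if k = 0 then 1 else 0

/-- The `q`-factorial `(1 - q) (1 - q ^ 2) ⋯ (1 - q ^ n)`. -/
noncomputable def qPoch (n : ℕ) : RatFunc ℚ := ∏ i ∈ Finset.range n, (1 - q ^ (i + 1))

lemma q_ne_zero : q ≠ 0 := RatFunc.X_ne_zero

lemma one_sub_q_pow_ne_zero (i : ℕ) : (1 : RatFunc ℚ) - q ^ (i + 1) ≠ 0 := by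
  intro h
  have h2 : algebraMap (Polynomial ℚ) (RatFunc ℚ) (Polynomial.X ^ (i + 1)) =
      algebraMap (Polynomial ℚ) (RatFunc ℚ) 1 := by
    rw [map_pow, map_one, RatFunc.algebraMap_X]
    exact (sub_eq_zero.mp h).symm
  have h3 := congrArg Polynomial.natDegree (RatFunc.algebraMap_injective ℚ h2)
  simp at h3

lemma qPoch_ne_zero (n : ℕ) : qPoch n ≠ 0 :=
  Finset.prod_ne_zero_iff.mpr fun i _ => one_sub_q_pow_ne_zero i

lemma qPoch_succ (n : ℕ) : qPoch (n + 1) = qPoch n * (1 - q ^ (n + 1)) :=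
  Finset.prod_range_succ _ _

lemma qPoch_add (b a : ℕ) :
    qPoch (b + a) = qPoch b * ∏ i ∈ Finset.range a, (1 - q ^ (b + i + 1)) :=
  Finset.prod_range_add _ _ _

lemma qbinom_add_left (a b : ℕ) :
    qbinom ((a + b : ℕ) : ℤ) (a : ℤ) = qPoch (a + b) / (qPoch a * qPoch b) := by
  have h1 : ∏ i ∈ Finset.range a,
      (1 - q ^ (((a + b : ℕ) : ℤ) - a + (i : ℤ) + 1)) / (1 - q ^ ((i : ℤ) + 1)) =
      (∏ i ∈ Finset.range a, (1 - q ^ (b + i + 1))) / qPoch a := by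
    rw [qPoch, ← Finset.prod_div_distrib]
    refine Finset.prod_congr rfl fun i _ => ?_
    have e1 : ((a + b : ℕ) : ℤ) - a + (i : ℤ) + 1 = ((b + i + 1 : ℕ) : ℤ) := by push_cast; ring
    have e2 : (i : ℤ) + 1 = ((i + 1 : ℕ) : ℤ) := by push_cast; ring
    rw [e1, e2, zpow_natCast, zpow_natCast]
  rw [qbinom, if_pos (by constructor <;> omega), Int.toNat_natCast, h1, add_comm a b, qPoch_add]
  have := qPoch_ne_zero a
  have := qPoch_ne_zero b
  field_simp

lemma qbinom_eq_zero_of_lt {n k : ℕ} (h : n < k) : qbinom (n : ℤ) (k : ℤ) = 0 := by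
  rw [qbinom, if_neg (by omega), if_neg (by omega)]

lemma qbinom_neg_one (n : ℤ) : qbinom n (-1) = 0 := by
  simp [qbinom]

lemma qbinom_zero_right (n : ℕ) : qbinom (n : ℤ) ((0 : ℕ) : ℤ) = 1 := by
  simp [qbinom]

lemma qbinom_self (n : ℕ) : qbinom (n : ℤ) (n : ℤ) = 1 := by
  have h := qbinom_add_left n 0
  have := qPoch_ne_zero n
  rw [add_zero] at h
  rw [h, show qPoch 0 = 1 from Finset.prod_range_zero _, mul_one, div_self this]

/-- The `q`-Pascal rule `[n+1, k+1] = [n, k] + q ^ (k+1) [n, k+1]`. -/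
lemma qbinom_succ_succ (n k : ℕ) : qbinom ((n + 1 : ℕ) : ℤ) ((k + 1 : ℕ) : ℤ) =
    qbinom (n : ℤ) (k : ℤ) + q ^ (k + 1) * qbinom (n : ℤ) ((k + 1 : ℕ) : ℤ) := by
  rcases lt_trichotomy n k with h | rfl | h
  · simp only [qbinom_eq_zero_of_lt h, qbinom_eq_zero_of_lt (show n + 1 < k + 1 by omega),
      qbinom_eq_zero_of_lt (show n < k + 1 by omega), mul_zero, add_zero]
  · rw [qbinom_eq_zero_of_lt (Nat.lt_succ_self n), qbinom_self, qbinom_self, mul_zero, add_zero]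
  · obtain ⟨b, rfl⟩ := Nat.exists_eq_add_of_lt h
    have h1 := qbinom_add_left (k + 1) (b + 1)
    have h2 := qbinom_add_left k (b + 1)
    have h3 := qbinom_add_left (k + 1) b
    rw [show k + 1 + (b + 1) = k + b + 1 + 1 by ring] at h1
    rw [show k + (b + 1) = k + b + 1 by ring] at h2
    rw [show k + 1 + b = k + b + 1 by ring] at h3
    rw [h1, h2, h3, qPoch_succ (k + b + 1), qPoch_succ k, qPoch_succ b]
    have := qPoch_ne_zero k
    have := qPoch_ne_zero b
    have := one_sub_q_pow_ne_zero k
    have := one_sub_q_pow_ne_zero b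
    field_simp
    ring

/-- The `q`-Pascal rule `[n+1, k+1] = [n, k+1] + q ^ (n-k) [n, k]`. -/
lemma qbinom_succ_succ' {n k : ℕ} (hk : k ≤ n) : qbinom ((n + 1 : ℕ) : ℤ) ((k + 1 : ℕ) : ℤ) =
    qbinom (n : ℤ) ((k + 1 : ℕ) : ℤ) + q ^ (n - k) * qbinom (n : ℤ) (k : ℤ) := by
  rcases hk.eq_or_lt with rfl | h
  · rw [qbinom_eq_zero_of_lt (Nat.lt_succ_self k), qbinom_self, qbinom_self]
    simp
  · obtain ⟨b, rfl⟩ := Nat.exists_eq_add_of_lt h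
    have h1 := qbinom_add_left (k + 1) (b + 1)
    have h2 := qbinom_add_left k (b + 1)
    have h3 := qbinom_add_left (k + 1) b
    rw [show k + 1 + (b + 1) = k + b + 1 + 1 by ring] at h1
    rw [show k + (b + 1) = k + b + 1 by ring] at h2
    rw [show k + 1 + b = k + b + 1 by ring] at h3
    rw [show k + b + 1 - k = b + 1 by omega, h1, h2, h3, qPoch_succ (k + b + 1), qPoch_succ k,
      qPoch_succ b]
    have := qPoch_ne_zero k
    have := qPoch_ne_zero b
    have := one_sub_q_pow_ne_zero k
    have := one_sub_q_pow_ne_zero b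
    field_simp
    ring

lemma qbinom_mul_qbinom {n m j : ℕ} (hj : j ≤ m) (hm : m + j ≤ n) :
    qbinom ((n - j : ℕ) : ℤ) (j : ℤ) * qbinom ((n - 2 * j : ℕ) : ℤ) ((m - j : ℕ) : ℤ) =
      qbinom (m : ℤ) (j : ℤ) * qbinom ((n - j : ℕ) : ℤ) (m : ℤ) := by
  obtain ⟨a, rfl⟩ := Nat.exists_eq_add_of_le hj
  obtain ⟨b, rfl⟩ := Nat.exists_eq_add_of_le hm
  have h1 := qbinom_add_left j (a + b)
  have h2 := qbinom_add_left a b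
  have h3 := qbinom_add_left j a
  have h4 := qbinom_add_left (j + a) b
  rw [← add_assoc] at h1
  rw [show j + a + j + b - j = j + a + b by omega, show j + a + j + b - 2 * j = a + b by omega,
    show j + a - j = a by omega, h1, h2, h3, h4]
  have := qPoch_ne_zero j
  have := qPoch_ne_zero a
  have := qPoch_ne_zero b
  have := qPoch_ne_zero (a + b)
  have := qPoch_ne_zero (j + a)
  field_simp

lemma sum_alternating_qbinom_mul_qbinom (m d : ℕ) :
    ∑ j ∈ Finset.range (m + 1), (-1 : RatFunc ℚ) ^ j * q ^ (j * (j - 1) / 2 + j) *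
      (qbinom (m : ℤ) (j : ℤ) * qbinom ((m + d - j : ℕ) : ℤ) (m : ℤ)) = 1 := by
  induction m with
  | zero => simp [qbinom]
  | succ m ih =>
    set c : ℕ → RatFunc ℚ := fun j => (-1 : RatFunc ℚ) ^ j * q ^ (j * (j - 1) / 2 + j) with hc
    set X : ℕ → RatFunc ℚ := fun j => qbinom ((m + 1 + d - j : ℕ) : ℤ) ((m + 1 : ℕ) : ℤ) with hX
    have hshift : ∑ j ∈ Finset.range (m + 1), c (j + 1) * (qbinom m ((j + 1 : ℕ) : ℤ) * X (j + 1)) +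
        c 0 * (qbinom m ((0 : ℕ) : ℤ) * X 0) =
        ∑ j ∈ Finset.range (m + 1), c j * (qbinom m (j : ℤ) * X j) := by
      rw [← Finset.sum_range_succ' (fun j => c j * (qbinom m (j : ℤ) * X j)),
        Finset.sum_range_succ, qbinom_eq_zero_of_lt (Nat.lt_succ_self m)]
      ring
    have hpascal : ∀ j ∈ Finset.range (m + 1),
        c (j + 1) * (qbinom ((m + 1 : ℕ) : ℤ) ((j + 1 : ℕ) : ℤ) * X (j + 1)) =
        c (j + 1) * (qbinom m ((j + 1 : ℕ) : ℤ) * X (j + 1)) -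
          c j * (qbinom m (j : ℤ) * (q ^ (m + 1) * X (j + 1))) := by
      intro j hj
      have hj : j ≤ m := Nat.lt_succ_iff.mp (Finset.mem_range.mp hj)
      obtain ⟨a, rfl⟩ := Nat.exists_eq_add_of_le hj
      rw [qbinom_succ_succ' hj, Nat.add_sub_cancel_left]
      simp only [hc]
      rw [Nat.triangle_succ]
      ring
    have hX_sub : ∀ j ∈ Finset.range (m + 1),
        X j - q ^ (m + 1) * X (j + 1) = qbinom ((m + d - j : ℕ) : ℤ) (m : ℤ) := by
      intro j hj
      have hj : j ≤ m := Nat.lt_succ_iff.mp (Finset.mem_range.mp hj)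
      simp only [hX]
      rw [show m + 1 + d - j = m + d - j + 1 by omega,
        show m + 1 + d - (j + 1) = m + d - j by omega, qbinom_succ_succ]
      ring
    change ∑ j ∈ Finset.range (m + 1 + 1),
      c j * (qbinom ((m + 1 : ℕ) : ℤ) (j : ℤ) * X j) = 1
    rw [Finset.sum_range_succ', Finset.sum_congr rfl hpascal, Finset.sum_sub_distrib,
      qbinom_zero_right (m + 1), ← qbinom_zero_right m, sub_add_eq_add_sub, hshift,
      ← Finset.sum_sub_distrib, qbinom_zero_right]
    refine (Finset.sum_congr rfl fun j hj => ?_).trans ih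
    rw [← hX_sub j hj]
    ring

/-- The two coefficient arrays of the Carlitz inversion formula are inverse to each other. -/
lemma sum_carlitz_coeff_mul_eq_zero {n m : ℕ} (hm : 2 * (m + 1) ≤ n) :
    ∑ j ∈ Finset.range (m + 1 + 1),
      ((-1 : RatFunc ℚ) ^ j * q ^ (j * (j - 1) / 2) * qbinom ((n : ℤ) - j) j) *
        (q ^ (-((m + 1 - j : ℕ) : ℤ)) * (qbinom ((n - 2 * j : ℕ) : ℤ) ((m + 1 - j : ℕ) : ℤ) -
          qbinom ((n - 2 * j : ℕ) : ℤ) (((m + 1 - j : ℕ) : ℤ) - 1))) = 0 := by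
  have hq := q_ne_zero
  have hpow : ∀ j ≤ m + 1, q ^ (-((m + 1 - j : ℕ) : ℤ)) = (q ^ (m + 1))⁻¹ * q ^ j := by
    intro j hj
    obtain ⟨a, ha⟩ := Nat.exists_eq_add_of_le hj
    rw [ha, Nat.add_sub_cancel_left, zpow_neg, zpow_natCast, pow_add]
    field_simp
  have hcast : ∀ j ≤ m + 1, (n : ℤ) - j = ((n - j : ℕ) : ℤ) := by
    intro j hj
    omega
  have hfirst : ∑ j ∈ Finset.range (m + 1 + 1),
      (-1 : RatFunc ℚ) ^ j * q ^ (j * (j - 1) / 2 + j) * (qbinom ((n - j : ℕ) : ℤ) (j : ℤ) *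
        qbinom ((n - 2 * j : ℕ) : ℤ) ((m + 1 - j : ℕ) : ℤ)) = 1 := by
    refine (Finset.sum_congr rfl fun j hj => ?_).trans
      (sum_alternating_qbinom_mul_qbinom (m + 1) (n - (m + 1)))
    have hj := Finset.mem_range.mp hj
    rw [qbinom_mul_qbinom (show j ≤ m + 1 by omega) (by omega),
      show m + 1 + (n - (m + 1)) = n by omega]
  have hsecond : ∑ j ∈ Finset.range (m + 1 + 1),
      (-1 : RatFunc ℚ) ^ j * q ^ (j * (j - 1) / 2 + j) * (qbinom ((n - j : ℕ) : ℤ) (j : ℤ) *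
        qbinom ((n - 2 * j : ℕ) : ℤ) (((m + 1 - j : ℕ) : ℤ) - 1)) = 1 := by
    rw [Finset.sum_range_succ, Nat.sub_self, Nat.cast_zero, zero_sub, qbinom_neg_one, mul_zero,
      mul_zero, add_zero]
    refine (Finset.sum_congr rfl fun j hj => ?_).trans
      (sum_alternating_qbinom_mul_qbinom m (n - m))
    have hj := Finset.mem_range.mp hj
    rw [show ((m + 1 - j : ℕ) : ℤ) - 1 = ((m - j : ℕ) : ℤ) by omega,
      qbinom_mul_qbinom (show j ≤ m by omega) (by omega), show m + (n - m) = n by omega]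
  have hdiff := sub_eq_zero.mpr (hfirst.trans hsecond.symm)
  rw [← Finset.sum_sub_distrib] at hdiff
  refine Eq.trans ?_ ((congrArg ((q ^ (m + 1))⁻¹ * ·) hdiff).trans (mul_zero _))
  simp only [Finset.mul_sum]
  refine Finset.sum_congr rfl fun j hj => ?_
  have hj : j ≤ m + 1 := Nat.lt_succ_iff.mp (Finset.mem_range.mp hj)
  rw [hpow j hj, hcast j hj, pow_add q (j * (j - 1) / 2)]
  ring

/-- Carlitz's inversion formula (Carlitz, Theorem 7). -/
theorem carlitz_inversion (V : Type*) [AddCommGroup V] [Module (RatFunc ℚ) V]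
    (u v : ℕ → V)
    (h : ∀ n : ℕ, u n = ∑ k ∈ Finset.range (n / 2 + 1),
      (q ^ (-(k : ℤ)) * (qbinom n k - qbinom n ((k : ℤ) - 1))) • v (n - 2 * k)) :
    ∀ n : ℕ, v n = ∑ j ∈ Finset.range (n / 2 + 1),
      ((-1 : RatFunc ℚ) ^ j * q ^ (j * (j - 1) / 2) * qbinom ((n : ℤ) - j) j) • u (n - 2 * j) := by
  intro n
  set B : ℕ → RatFunc ℚ := fun j =>
    (-1 : RatFunc ℚ) ^ j * q ^ (j * (j - 1) / 2) * qbinom ((n : ℤ) - j) j with hB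
  set A : ℕ → ℕ → RatFunc ℚ := fun j k => q ^ (-(k : ℤ)) *
    (qbinom ((n - 2 * j : ℕ) : ℤ) k - qbinom ((n - 2 * j : ℕ) : ℤ) ((k : ℤ) - 1)) with hA
  have hexpand : ∀ j ∈ Finset.range (n / 2 + 1), B j • u (n - 2 * j) =
      ∑ k ∈ Finset.range (n / 2 + 1 - j), (B j * A j k) • v (n - 2 * (j + k)) := by
    intro j hj
    have hj := Finset.mem_range.mp hj
    rw [h, Finset.smul_sum, show (n - 2 * j) / 2 + 1 = n / 2 + 1 - j by omega]
    refine Finset.sum_congr rfl fun k _ => ?_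
    rw [smul_smul, show n - 2 * j - 2 * k = n - 2 * (j + k) by omega]
  rw [Finset.sum_congr rfl hexpand,
    ← Finset.sum_range_diag_flip (n / 2 + 1) fun j k => (B j * A j k) • v (n - 2 * (j + k)),
    Finset.sum_range_succ', Finset.sum_eq_zero]
  · simp [hA, hB, qbinom]
  · intro m hm
    have hm := Finset.mem_range.mp hm
    have hcollect : ∀ j ∈ Finset.range (m + 1 + 1),
        (B j * A j (m + 1 - j)) • v (n - 2 * (j + (m + 1 - j))) =
          (B j * A j (m + 1 - j)) • v (n - 2 * (m + 1)) := by
      intro j hj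
      have hj := Finset.mem_range.mp hj
      rw [show j + (m + 1 - j) = m + 1 by omega]
    rw [Finset.sum_congr rfl hcollect, ← Finset.sum_smul,
      sum_carlitz_coeff_mul_eq_zero (show 2 * (m + 1) ≤ n by omega), zero_smul]
end

section
/- For every n ∈ ℕ the expansion x^n = ∑_{k=0}^{n} b(n,k,t,q) L_k(x,t,q) holds in ℚ(q,t)[x]. In particular b(2n,0,t,q) = ∑_{j=0}^{n} q^{j²} [n choose j]_q² t^j = M_n(t,q), so the linear functional M on ℚ(q,t)-linear combinations of the polynomials L_k(x,t,q) determined by M(L_k(x,t,q)) = [k=0] satisfies M(x^{2n}) = M_n(t,q). -/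
open Finset Polynomial

/-- The field `ℚ(q,t)` of rational functions in two independent indeterminates,
realized as `ℚ(q)(t)`. -/
noncomputable abbrev F2 : Type := RatFunc (RatFunc ℚ)

/-- The indeterminate `q`, viewed in `ℚ(q,t)`. -/
noncomputable def qq : F2 := RatFunc.C RatFunc.X

/-- The indeterminate `t`, viewed in `ℚ(q,t)`. -/
noncomputable def tt : F2 := RatFunc.X

/-- The Gaussian binomial coefficient `[n choose k]_q`, viewed in `ℚ(q,t)`. -/
noncomputable def qbinomF (n k : ℤ) : F2 :=
  if 0 ≤ k ∧ k ≤ n then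
    ∏ i ∈ Finset.range k.toNat, (1 - qq ^ (n - k + (i : ℤ) + 1)) / (1 - qq ^ ((i : ℤ) + 1))
  else if k = 0 then 1 else 0

/-- `τ_0(t,q) = 1 + qt`, `τ_{2m}(t,q) = q^m (1 + q^{m+1} t^{m+1})/(1 + q^m t^m)` for
`m ≥ 1`, and `τ_{2m+1}(t,q) = q^{m+1} t (1 + t^m)/(1 + t^{m+1})`, as a function of an
arbitrary value substituted for `t`. -/
noncomputable def tauB (m : ℤ) (t : F2) : F2 :=
  if m = 0 then 1 + qq * t
  else if m % 2 = 0 then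
    qq ^ (m / 2) * (1 + qq ^ (m / 2 + 1) * t ^ (m / 2 + 1)) / (1 + qq ^ (m / 2) * t ^ (m / 2))
  else qq ^ ((m - 1) / 2 + 1) * t * (1 + t ^ ((m - 1) / 2)) / (1 + t ^ ((m - 1) / 2 + 1))

/-- The generalized q-Lucas polynomials `L_n(x,t,q) ∈ ℚ(q,t)[x]` (as functions of the
value substituted for `t`): `L_0 = 1`, `L_1 = x`, and
`L_n(x,t,q) = x L_{n−1}(x,qt,q) − τ_{n−2}(t,q) L_{n−2}(x,t,q)`. -/
noncomputable def genL : ℕ → F2 → Polynomial F2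
  | 0, _ => 1
  | 1, _ => Polynomial.X
  | n + 2, t =>
      Polynomial.X * genL (n + 1) (qq * t) - Polynomial.C (tauB (n : ℤ) t) * genL n t

/-- The connection coefficients `b(m, j, t, q) ∈ ℚ(q,t)`, as functions of the value
substituted for `t`; `b(m,j,t,q) = 0` whenever `m − j` is odd or `j < 0` or `j > m`. -/
noncomputable def coeffBB (m j : ℤ) (t : F2) : F2 :=
  if 0 ≤ j ∧ j ≤ m ∧ (m - j) % 2 = 0 then
    if m % 2 = 0 then
      ∑ i ∈ Finset.range ((m / 2 - j / 2).toNat + 1),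
        qq ^ ((i : ℤ) * ((i : ℤ) + j / 2)) * qbinomF (m / 2) i *
          qbinomF (m / 2) ((i : ℤ) + j / 2) * t ^ (i : ℕ)
    else
      (1 + t ^ (j / 2 + 1))⁻¹ *
        ∑ i ∈ Finset.range ((m / 2 - j / 2).toNat + 1),
          qbinomF (m / 2) (j / 2 + (i : ℤ)) * qbinomF (m / 2 + 1) i *
            (qq ^ ((i : ℤ) * ((i : ℤ) + j / 2)) * t ^ (i : ℕ) +
             qq ^ ((m / 2 + 1 - (i : ℤ)) * (m / 2 - (i : ℤ) - j / 2)) * t ^ (m / 2 + 1 - (i : ℤ)))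
  else 0

/-- The q-Narayana polynomial of type B, `M_n(t,q) = ∑_{j=0}^{n} q^{j²} [n choose j]² t^j`,
viewed in `ℚ(q,t)`. -/
noncomputable def typeB (n : ℕ) : F2 :=
  ∑ j ∈ Finset.range (n + 1), qq ^ (j ^ 2) * qbinomF n j ^ 2 * tt ^ j
lemma qq_ne_zero : qq ≠ 0 := by
  simp [qq, RatFunc.X_ne_zero]

lemma qq_pow_ne_one {n : ℕ} (hn : n ≠ 0) : qq ^ n ≠ 1 := by
  intro h
  have h' : (RatFunc.X : RatFunc ℚ) ^ n = 1 := by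
    apply RatFunc.C_injective
    simpa [qq] using h
  have h2 : (Polynomial.X : ℚ[X]) ^ n = 1 := by
    apply RatFunc.algebraMap_injective ℚ
    simpa using h'
  have h3 := congrArg (Polynomial.eval 0) h2
  simp [hn] at h3

lemma one_sub_qq_zpow_ne_zero (i : ℕ) : 1 - qq ^ ((i : ℤ) + 1) ≠ 0 := by
  intro h
  have h1 := qq_pow_ne_one (Nat.succ_ne_zero i)
  apply h1
  rw [sub_eq_zero] at h
  exact_mod_cast h.symm

/-- The substituted values of `t` for which no denominator of the recurrence vanishes. -/
def IsGeneric (t : F2) : Prop :=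
  t ≠ 0 ∧ ∀ a k : ℕ, 1 + qq ^ a * t ^ k ≠ 0

lemma isGeneric_tt : IsGeneric tt := by
  refine ⟨RatFunc.X_ne_zero, fun a k h => ?_⟩
  have h1 : (1 + Polynomial.C (RatFunc.X ^ a) * Polynomial.X ^ k : (RatFunc ℚ)[X]) = 0 := by
    apply RatFunc.algebraMap_injective (RatFunc ℚ)
    simpa [qq, tt] using h
  have h2 := congrArg (Polynomial.eval 1) h1
  have h3 : (1 + Polynomial.X ^ a : ℚ[X]) = 0 := by
    apply RatFunc.algebraMap_injective ℚ
    simpa using h2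
  have h4 := congrArg (Polynomial.eval 1) h3
  norm_num at h4

lemma IsGeneric.qq_mul {t : F2} (ht : IsGeneric t) : IsGeneric (qq * t) := by
  refine ⟨mul_ne_zero qq_ne_zero ht.1, fun a k => ?_⟩
  have := ht.2 (a + k) k
  rwa [mul_pow, ← mul_assoc, ← pow_add]

/-! ### Gaussian binomial coefficients -/

lemma qbinomF_of_neg (n : ℤ) {k : ℤ} (hk : k < 0) : qbinomF n k = 0 := by
  rw [qbinomF, if_neg (by omega), if_neg (by omega)]

lemma qbinomF_of_lt {n k : ℤ} (hn : 0 ≤ n) (hk : n < k) : qbinomF n k = 0 := by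
  rw [qbinomF, if_neg (by omega), if_neg (by omega)]

lemma qbinomF_eq_prod_div {n : ℤ} (hn : 0 ≤ n) (k : ℕ) (hk : (k : ℤ) ≤ n + 1) :
    qbinomF n k = (∏ i ∈ range k, (1 - qq ^ (n - k + (i : ℤ) + 1))) /
      ∏ i ∈ range k, (1 - qq ^ ((i : ℤ) + 1)) := by
  rw [← prod_div_distrib]
  by_cases h : (k : ℤ) ≤ n
  · rw [qbinomF, if_pos ⟨by omega, h⟩, Int.toNat_natCast]
  · rw [qbinomF_of_lt hn (by omega)]
    symm
    apply prod_eq_zero (i := 0) (by simp; omega)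
    rw [show n - (k : ℤ) + ((0 : ℕ) : ℤ) + 1 = 0 by push_cast; omega]
    simp

lemma qbinomF_zero_right (n : ℤ) : qbinomF n 0 = 1 := by
  simp [qbinomF]

lemma prod_one_sub_qq_ne_zero (k : ℕ) : ∏ i ∈ range k, (1 - qq ^ ((i : ℤ) + 1)) ≠ 0 :=
  prod_ne_zero_iff.2 fun i _ => one_sub_qq_zpow_ne_zero i

lemma qbinomF_succ {n : ℤ} (hn : 0 ≤ n) (k : ℤ) :
    qbinomF (n + 1) k = qq ^ k * qbinomF n k + qbinomF n (k - 1) := by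
  rcases lt_trichotomy k 0 with hk | rfl | hk
  · simp [qbinomF_of_neg _ hk, qbinomF_of_neg n (show k - 1 < 0 by omega)]
  · simp [qbinomF_zero_right, qbinomF_of_neg n (show (-1 : ℤ) < 0 by omega)]
  by_cases hkn : n + 1 < k
  · rw [qbinomF_of_lt (by omega) hkn, qbinomF_of_lt hn (by omega), qbinomF_of_lt hn (by omega)]
    simp
  obtain ⟨j, rfl⟩ : ∃ j : ℕ, k = ((j + 1 : ℕ) : ℤ) := ⟨(k - 1).toNat, by omega⟩
  rw [show ((j + 1 : ℕ) : ℤ) - 1 = j by push_cast; ring,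
    qbinomF_eq_prod_div hn _ (by omega), qbinomF_eq_prod_div hn _ (by omega),
    qbinomF_eq_prod_div (by omega) _ (by omega),
    prod_range_succ (fun i : ℕ => 1 - qq ^ (n + 1 - ((j + 1 : ℕ) : ℤ) + (i : ℤ) + 1)),
    prod_range_succ' (fun i : ℕ => 1 - qq ^ (n - ((j + 1 : ℕ) : ℤ) + (i : ℤ) + 1)),
    prod_range_succ (fun i : ℕ => 1 - qq ^ ((i : ℤ) + 1))]
  have h1 : ∀ i : ℕ, n + 1 - ((j + 1 : ℕ) : ℤ) + (i : ℤ) + 1 = n - j + i + 1 := by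
    intro i; push_cast; ring
  have h2 : ∀ i : ℕ, n - ((j + 1 : ℕ) : ℤ) + ((i + 1 : ℕ) : ℤ) + 1 = n - j + i + 1 := by
    intro i; push_cast; ring
  simp only [h1, h2]
  have hD := prod_one_sub_qq_ne_zero j
  have hj := one_sub_qq_zpow_ne_zero j
  have e1 : qq ^ (n - j + j + 1) = qq ^ ((j : ℤ) + 1) * qq ^ (n - j) := by
    rw [← zpow_add₀ qq_ne_zero]; congr 1; ring
  rw [e1, show n - ((j + 1 : ℕ) : ℤ) + ((0 : ℕ) : ℤ) + 1 = n - j by push_cast; ring,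
    show ((j + 1 : ℕ) : ℤ) = j + 1 by push_cast; ring]
  field_simp
  ring

lemma qbinomF_symm {n : ℤ} (hn : 0 ≤ n) (k : ℤ) : qbinomF n (n - k) = qbinomF n k := by
  by_cases h0 : k < 0
  · rw [qbinomF_of_neg n h0, qbinomF_of_lt hn (by omega)]
  by_cases h1 : n < k
  · rw [qbinomF_of_lt hn h1, qbinomF_of_neg n (by omega)]
  obtain ⟨a, rfl⟩ : ∃ a : ℕ, k = a := ⟨k.toNat, by omega⟩
  obtain ⟨b, hb⟩ : ∃ b : ℕ, n - a = b := ⟨(n - a).toNat, by omega⟩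
  have key : ∀ a b : ℕ, (∏ i ∈ range b, (1 - qq ^ ((i : ℤ) + 1))) *
      ∏ i ∈ range a, (1 - qq ^ ((b : ℤ) + (i : ℤ) + 1)) =
        ∏ i ∈ range (b + a), (1 - qq ^ ((i : ℤ) + 1)) := by
    intro a b
    rw [prod_range_add]
    push_cast
    rfl
  rw [hb, qbinomF_eq_prod_div hn _ (by omega), qbinomF_eq_prod_div hn _ (by omega), hb,
    show n - b = a by omega, div_eq_div_iff (prod_one_sub_qq_ne_zero b) (prod_one_sub_qq_ne_zero a),
    mul_comm, key, mul_comm, key, add_comm]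

/-! ### Evaluation of Laurent polynomials -/

/-- The value at `t` of the Laurent polynomial with coefficients `a`. -/
noncomputable def laurentEval (a : ℤ → F2) (t : F2) : F2 := ∑ᶠ i : ℤ, a i * t ^ i

lemma finite_support_of_bdd {a : ℤ → F2} (l u : ℤ) (h : ∀ i, i < l ∨ u < i → a i = 0) :
    (Function.support a).Finite := by
  refine (Set.finite_Icc l u).subset fun i hi => ?_
  by_contra hn
  exact hi (h i (by simp only [Set.mem_Icc] at hn; omega))

lemma laurentEval_add {a b : ℤ → F2} (ha : (Function.support a).Finite)
    (hb : (Function.support b).Finite) (t : F2) :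
    laurentEval (fun i => a i + b i) t = laurentEval a t + laurentEval b t := by
  simp only [laurentEval, add_mul]
  exact finsum_add_distrib (ha.subset (Function.support_mul_subset_left _ _))
    (hb.subset (Function.support_mul_subset_left _ _))

lemma laurentEval_const_mul (c : F2) (a : ℤ → F2) (t : F2) :
    laurentEval (fun i => c * a i) t = c * laurentEval a t := by
  simp only [laurentEval, mul_assoc]
  exact (smul_finsum c fun i => a i * t ^ i).symm

lemma laurentEval_shift {t : F2} (ht : t ≠ 0) (m : ℤ) (a : ℤ → F2) :
    laurentEval (fun i => a (i - m)) t = t ^ m * laurentEval a t := by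
  rw [← laurentEval_const_mul, laurentEval, laurentEval,
    ← finsum_comp_equiv (Equiv.subRight m) (f := fun i => t ^ m * a i * t ^ i)]
  refine finsum_congr fun i => ?_
  rw [Equiv.subRight_apply, mul_right_comm, ← zpow_add₀ ht, add_sub_cancel, mul_comm]

lemma laurentEval_qq_mul (a : ℤ → F2) (t : F2) :
    laurentEval a (qq * t) = laurentEval (fun i => a i * qq ^ i) t := by
  simp only [laurentEval, mul_zpow, mul_assoc]

lemma laurentEval_eq_sum_range {a : ℤ → F2} (N : ℕ)
    (h : ∀ i, i < 0 ∨ (N : ℤ) < i → a i = 0) (t : F2) :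
    laurentEval a t = ∑ i ∈ range (N + 1), a i * t ^ i := by
  rw [laurentEval, finsum_eq_sum_of_support_subset (s := (range (N + 1)).map Nat.castEmbedding)]
  · simp
  · intro i hi
    have : ¬ (i < 0 ∨ (N : ℤ) < i) := fun hn => hi (by simp [h i hn])
    simp only [coe_map, Set.mem_image, coe_range, Set.mem_Iio, Nat.castEmbedding_apply]
    exact ⟨i.toNat, by omega, by omega⟩

/-! ### The connection coefficients as Laurent polynomials -/

/-- The coefficient of `t ^ i` in `b(2n,2k,t,q)`. -/
noncomputable def evenTerm (n k i : ℤ) : F2 :=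
  qq ^ (i * (i + k)) * qbinomF n i * qbinomF n (i + k)

/-- The coefficient of `t ^ i` in `(1 + t ^ (k+1)) b(2n+1,2k+1,t,q)`. -/
noncomputable def oddTerm (n k i : ℤ) : F2 :=
  qbinomF (n + 1) i * (qq ^ (i * (i + k)) * qbinomF n (i + k) +
    qq ^ (i * (i - k - 1)) * qbinomF n (i - k - 1))

lemma evenTerm_eq_zero {n : ℤ} (hn : 0 ≤ n) (k : ℤ) {i : ℤ} (hi : i < 0 ∨ n < i) :
    evenTerm n k i = 0 := by
  rcases hi with hi | hi
  · simp [evenTerm, qbinomF_of_neg n hi]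
  · simp [evenTerm, qbinomF_of_lt hn hi]

lemma oddTerm_eq_zero {n : ℤ} (hn : 0 ≤ n) (k : ℤ) {i : ℤ} (hi : i < 0 ∨ n + 1 < i) :
    oddTerm n k i = 0 := by
  rcases hi with hi | hi
  · simp [oddTerm, qbinomF_of_neg _ hi]
  · simp [oddTerm, qbinomF_of_lt (show 0 ≤ n + 1 by omega) hi]

lemma oddTerm_eq_evenTerm {n : ℤ} (hn : 0 ≤ n) (k i : ℤ) :
    oddTerm n k i = evenTerm n k i * qq ^ i
      + evenTerm n k (i - (k + 1)) * qq ^ (i - (k + 1))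
      + qq ^ (k + 1) * (evenTerm n (k + 1) (i - 1) * qq ^ (i - 1))
      + qq ^ (k + 1) * (evenTerm n (k + 1) (i - (k + 1)) * qq ^ (i - (k + 1))) := by
  have hq := qq_ne_zero
  have e1 : qq ^ (i * (i + k)) =
      qq ^ (k + 1) * (qq ^ ((i - 1) * (i - 1 + (k + 1))) * qq ^ (i - 1)) := by
    rw [← zpow_add₀ hq, ← zpow_add₀ hq]; congr 1; ring
  have e2 : qq ^ (i * (i - k - 1)) =
      qq ^ ((i - (k + 1)) * (i - (k + 1) + k)) * qq ^ (i - (k + 1)) := by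
    rw [← zpow_add₀ hq]; congr 1; ring
  have e3 : qq ^ (i * (i - k - 1)) * qq ^ i = qq ^ (k + 1) *
      (qq ^ ((i - (k + 1)) * (i - (k + 1) + (k + 1))) * qq ^ (i - (k + 1))) := by
    rw [← zpow_add₀ hq, ← zpow_add₀ hq, ← zpow_add₀ hq]; congr 1; ring
  rw [oddTerm, qbinomF_succ hn]
  simp only [evenTerm]
  rw [show i - 1 + (k + 1) = i + k by ring, show i - (k + 1) + k = i - 1 by ring,
    show i - (k + 1) + (k + 1) = i by ring, show i - k - 1 = i - (k + 1) by ring] at *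
  linear_combination (qbinomF n (i - 1) * qbinomF n (i + k)) * e1 +
    (qbinomF n (i - 1) * qbinomF n (i - (k + 1))) * e2 +
    (qbinomF n i * qbinomF n (i - (k + 1))) * e3

lemma evenTerm_succ {n : ℤ} (hn : 0 ≤ n) (k i : ℤ) :
    evenTerm (n + 1) k i + qq ^ k * evenTerm (n + 1) k (i - k) =
      oddTerm n (k - 1) i * qq ^ i + qq ^ k * (oddTerm n k i * qq ^ i) := by
  have hq := qq_ne_zero
  have e1 : qq ^ (i * (i + k)) = qq ^ (i * (i + (k - 1))) * qq ^ i := by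
    rw [← zpow_add₀ hq]; congr 1; ring
  have e2 : qq ^ (i + k) = qq ^ k * qq ^ i := by
    rw [← zpow_add₀ hq]; congr 1; ring
  have e3 : qq ^ (i * (i - k)) = qq ^ (i * (i - k - 1)) * qq ^ i := by
    rw [← zpow_add₀ hq]; congr 1; ring
  have e4 : qq ^ k * qq ^ (i - k) = qq ^ i := by
    rw [← zpow_add₀ hq]; congr 1; ring
  have p1 := qbinomF_succ hn (i + k)
  have p2 := qbinomF_succ hn (i - k)
  simp only [evenTerm, oddTerm]
  rw [show i - k + k = i by ring, show (i - k) * i = i * (i - k) by ring,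
    show i - (k - 1) - 1 = i - k by ring, p1, p2, show i + k - 1 = i + (k - 1) by ring]
  linear_combination
    (qbinomF (n + 1) i * qbinomF n (i + (k - 1))) * e1 +
    (qbinomF (n + 1) i * qbinomF n (i + k)) * qq ^ (i * (i + k)) * e2 +
    (qbinomF (n + 1) i * qbinomF n (i - k)) * qq ^ (i * (i - k)) * e4 +
    (qq ^ k * qbinomF (n + 1) i * qbinomF n (i - k - 1)) * e3

lemma finite_support_evenTerm {n : ℤ} (hn : 0 ≤ n) (k m : ℤ) (c : ℤ → F2) :
    (Function.support fun i => c i * evenTerm n k (i - m)).Finite :=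
  finite_support_of_bdd m (n + m) fun i hi => by
    rw [evenTerm_eq_zero hn k (by omega), mul_zero]

lemma finite_support_oddTerm {n : ℤ} (hn : 0 ≤ n) (k : ℤ) (c : ℤ → F2) :
    (Function.support fun i => c i * oddTerm n k i).Finite :=
  finite_support_of_bdd 0 (n + 1) fun i hi => by
    rw [oddTerm_eq_zero hn k hi, mul_zero]

lemma laurentEval_oddTerm {n : ℤ} (hn : 0 ≤ n) (k : ℤ) {t : F2} (ht : t ≠ 0) :
    laurentEval (oddTerm n k) t = (1 + t ^ (k + 1)) * laurentEval (evenTerm n k) (qq * t) +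
      qq ^ (k + 1) * t * (1 + t ^ k) * laurentEval (evenTerm n (k + 1)) (qq * t) := by
  have hs : ∀ j m, (Function.support fun i => evenTerm n j (i - m) * qq ^ (i - m)).Finite := by
    intro j m
    simpa only [mul_comm] using finite_support_evenTerm hn j m fun i => qq ^ (i - m)
  have hc : ∀ j m, (Function.support fun i =>
      qq ^ (k + 1) * (evenTerm n j (i - m) * qq ^ (i - m))).Finite := fun j m =>
    (hs j m).subset (Function.support_mul_subset_right _ _)
  have h0 := hs k 0
  simp only [sub_zero] at h0
  have hadd {a b : ℤ → F2} (ha : (Function.support a).Finite) (hb : (Function.support b).Finite) :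
      (Function.support fun i => a i + b i).Finite :=
    (ha.union hb).subset (Function.support_add _ _)
  rw [funext (oddTerm_eq_evenTerm hn k),
    laurentEval_add (hadd (hadd h0 (hs _ _)) (hc _ _)) (hc _ _),
    laurentEval_add (hadd h0 (hs _ _)) (hc _ _), laurentEval_add h0 (hs _ _),
    laurentEval_const_mul, laurentEval_const_mul,
    laurentEval_shift ht (k + 1) (fun i => evenTerm n k i * qq ^ i),
    laurentEval_shift ht 1 (fun i => evenTerm n (k + 1) i * qq ^ i),
    laurentEval_shift ht (k + 1) (fun i => evenTerm n (k + 1) i * qq ^ i),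
    ← laurentEval_qq_mul, ← laurentEval_qq_mul, zpow_add₀ ht, zpow_one]
  ring

lemma laurentEval_evenTerm_succ {n : ℤ} (hn : 0 ≤ n) (k : ℤ) {t : F2} (ht : t ≠ 0) :
    (1 + qq ^ k * t ^ k) * laurentEval (evenTerm (n + 1) k) t =
      laurentEval (oddTerm n (k - 1)) (qq * t) + qq ^ k * laurentEval (oddTerm n k) (qq * t) := by
  have hn' : 0 ≤ n + 1 := by omega
  have hE := finite_support_evenTerm hn' k 0 fun _ => 1
  simp only [sub_zero, one_mul] at hE
  have hO : ∀ j, (Function.support fun i => oddTerm n j i * qq ^ i).Finite := by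
    intro j
    simpa only [mul_comm] using finite_support_oddTerm hn j fun i => qq ^ i
  rw [laurentEval_qq_mul, laurentEval_qq_mul, ← laurentEval_const_mul (qq ^ k),
    ← laurentEval_add (hO _) ((hO _).subset (Function.support_mul_subset_right _ _)),
    ← funext (evenTerm_succ hn k), laurentEval_add hE (finite_support_evenTerm hn' k k _),
    laurentEval_const_mul, laurentEval_shift ht]
  ring

lemma oddTerm_neg (n k i : ℤ) : oddTerm n (-k - 1) i = oddTerm n k i := by
  rw [oddTerm, oddTerm, show i - (-k - 1) - 1 = i + k by ring,
    show i + (-k - 1) = i - k - 1 by ring]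
  ring

lemma coeffBB_even (n k : ℕ) (t : F2) :
    coeffBB (2 * n) (2 * k) t = laurentEval (evenTerm n k) t := by
  have hz : ∀ i : ℤ, i < 0 ∨ (n : ℤ) - k < i → evenTerm n k i = 0 := by
    rintro i (hi | hi)
    · simp [evenTerm, qbinomF_of_neg _ hi]
    · simp [evenTerm, qbinomF_of_lt (Int.natCast_nonneg n) (show (n : ℤ) < i + k by omega)]
  by_cases hk : k ≤ n
  · rw [coeffBB, if_pos (by omega), if_pos (by omega),
      laurentEval_eq_sum_range (n - k) fun i hi => hz i (by omega)]
    rw [show 2 * (n : ℤ) / 2 = n by omega, show 2 * (k : ℤ) / 2 = k by omega,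
      show ((n : ℤ) - k).toNat = n - k by omega]
    simp [evenTerm]
  · rw [coeffBB, if_neg (by omega), laurentEval,
      finsum_congr fun i => by rw [hz i (by omega), zero_mul], finsum_zero]

lemma coeffBB_odd (n k : ℕ) {t : F2} (ht : t ≠ 0) :
    coeffBB (2 * n + 1) (2 * k + 1) t =
      (1 + t ^ (k + 1))⁻¹ * laurentEval (oddTerm n k) t := by
  have hn : (0 : ℤ) ≤ n := Int.natCast_nonneg n
  have hz : ∀ i : ℤ, i < 0 ∨ (n : ℤ) - k < i → qbinomF (n + 1) i * qbinomF n (i + k) = 0 := by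
    rintro i (hi | hi)
    · simp [qbinomF_of_neg _ hi]
    · simp [qbinomF_of_lt hn (show (n : ℤ) < i + k by omega)]
  have hz' : ∀ i : ℤ, i ≤ k ∨ (n : ℤ) + 1 < i →
      qbinomF (n + 1) i * qbinomF n (i - k - 1) = 0 := by
    rintro i (hi | hi)
    · simp [qbinomF_of_neg n (show i - k - 1 < 0 by omega)]
    · simp [qbinomF_of_lt (show (0 : ℤ) ≤ n + 1 by omega) hi]
  let a : ℤ → F2 := fun i => qq ^ (i * (i + k)) * (qbinomF (n + 1) i * qbinomF n (i + k))
  let b : ℤ → F2 := fun i => qq ^ (i * (i - k - 1)) * (qbinomF (n + 1) i * qbinomF n (i - k - 1))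
  have ha : ∀ i : ℤ, i < 0 ∨ (n : ℤ) - k < i → a i = 0 := fun i hi => by
    simp only [a, hz i hi, mul_zero]
  have hb : ∀ i : ℤ, i ≤ k ∨ (n : ℤ) + 1 < i → b i = 0 := fun i hi => by
    simp only [b, hz' i hi, mul_zero]
  have hodd : oddTerm n k = fun i => a i + b i := by
    funext i; simp only [oddTerm, a, b]; ring
  rw [hodd]
  by_cases hk : k ≤ n
  · rw [coeffBB, if_pos (by omega), if_neg (by omega),
      show (2 * (n : ℤ) + 1) / 2 = n by omega, show (2 * (k : ℤ) + 1) / 2 = k by omega,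
      show ((n : ℤ) - k).toNat = n - k by omega]
    congr 1
    rw [laurentEval_add (finite_support_of_bdd 0 (n - k) ha)
      (finite_support_of_bdd (k + 1) (n + 1) fun i hi => hb i (by omega)),
      laurentEval_eq_sum_range (n - k) fun i hi => ha i (by omega)]
    have hrefl : laurentEval b t =
        laurentEval (fun i => b (n + 1 - i) * t ^ ((n : ℤ) + 1 - 2 * i)) t := by
      rw [laurentEval, laurentEval, ← finsum_comp_equiv (Equiv.subLeft ((n : ℤ) + 1))]
      refine finsum_congr fun i => ?_
      rw [Equiv.subLeft_apply, mul_assoc (b _), ← zpow_add₀ ht]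
      congr 2; ring
    rw [hrefl, laurentEval_eq_sum_range (n - k) fun i hi => by rw [hb _ (by omega), zero_mul],
      ← sum_add_distrib]
    refine sum_congr rfl fun i _ => ?_
    simp only [a, b]
    rw [← zpow_natCast t i, mul_assoc (_ * _) (t ^ _) (t ^ _), ← zpow_add₀ ht,
      show (n : ℤ) + 1 - 2 * i + i = n + 1 - i by ring,
      qbinomF_symm (show (0 : ℤ) ≤ n + 1 by omega),
      show (n : ℤ) + 1 - i - k - 1 = n - (k + i) by ring, qbinomF_symm hn,
      show (n : ℤ) - i - k = n - (k + i) by ring, add_comm (i : ℤ) k]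
    ring
  · rw [coeffBB, if_neg (by omega), laurentEval,
      finsum_congr fun i => by rw [ha i (by omega), hb i (by omega), add_zero, zero_mul],
      finsum_zero, mul_zero]

lemma coeffBB_of_parity {m j : ℤ} (h : (m - j) % 2 ≠ 0) (t : F2) : coeffBB m j t = 0 := by
  rw [coeffBB, if_neg (by tauto)]

lemma coeffBB_of_neg (m : ℤ) {j : ℤ} (h : j < 0) (t : F2) : coeffBB m j t = 0 := by
  rw [coeffBB, if_neg (by omega)]

lemma coeffBB_of_lt {m j : ℤ} (h : m < j) (t : F2) : coeffBB m j t = 0 := by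
  rw [coeffBB, if_neg (by omega)]

lemma coeffBB_succ_even {t : F2} (ht : IsGeneric t) (n k : ℕ) :
    coeffBB (2 * n + 2) (2 * k) t = coeffBB (2 * n + 1) (2 * k - 1) (qq * t) +
      tauB (2 * k) t * coeffBB (2 * n + 1) (2 * k + 1) (qq * t) := by
  have hqt := ht.qq_mul
  have key := laurentEval_evenTerm_succ (Int.natCast_nonneg n) k ht.1
  have hE := coeffBB_even (n + 1) k t
  push_cast at hE
  rw [show 2 * (n : ℤ) + 2 = 2 * (n + 1) by ring, hE, coeffBB_odd n k hqt.1]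
  rcases k with _ | k
  · have hS : laurentEval (oddTerm n (-1)) (qq * t) = laurentEval (oddTerm n 0) (qq * t) := by
      rw [← funext (oddTerm_neg n 0)]; simp
    have h1 := ht.2 1 1
    simp only [pow_one] at h1
    rw [coeffBB_of_neg _ (by simp)]
    simp only [Nat.cast_zero, zpow_zero, zero_sub, hS] at key
    simp only [Nat.cast_zero, tauB, mul_zero, if_true, zero_add, pow_one]
    rw [mul_inv_cancel_left₀ h1]
    linear_combination key / 2
  · have h1 := ht.2 (k + 1) (k + 1)
    have h2 := ht.2 (k + 2) (k + 2)
    have hO := coeffBB_odd n k hqt.1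
    rw [show 2 * ((k + 1 : ℕ) : ℤ) - 1 = 2 * k + 1 by push_cast; ring, hO, tauB,
      if_neg (by omega), if_pos (by omega),
      show 2 * ((k + 1 : ℕ) : ℤ) / 2 = ((k + 1 : ℕ) : ℤ) by omega,
      show ((k + 1 : ℕ) : ℤ) + 1 = ((k + 2 : ℕ) : ℤ) by push_cast; ring]
    rw [show ((k + 1 : ℕ) : ℤ) - 1 = k by push_cast; ring] at key
    simp only [zpow_natCast, mul_pow] at key ⊢
    rw [show k + 1 + 1 = k + 2 by ring]
    field_simp
    linear_combination key

lemma coeffBB_succ_odd {t : F2} (ht : IsGeneric t) (n k : ℕ) :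
    coeffBB (2 * n + 1) (2 * k + 1) t = coeffBB (2 * n) (2 * k) (qq * t) +
      tauB (2 * k + 1) t * coeffBB (2 * n) (2 * k + 2) (qq * t) := by
  have key := laurentEval_oddTerm (Int.natCast_nonneg n) k ht.1
  have hE := coeffBB_even n (k + 1) (qq * t)
  have h1 := ht.2 0 (k + 1)
  simp only [pow_zero, one_mul] at h1
  push_cast at hE
  rw [coeffBB_odd n k ht.1, coeffBB_even, show 2 * (k : ℤ) + 2 = 2 * (k + 1) by ring, hE, tauB,
    if_neg (by omega), if_neg (by omega), show (2 * (k : ℤ) + 1 - 1) / 2 = k by omega, key,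
    show (k : ℤ) + 1 = ((k + 1 : ℕ) : ℤ) by push_cast; ring]
  simp only [zpow_natCast]
  field_simp

lemma coeffBB_succ {t : F2} (ht : IsGeneric t) (n k : ℕ) :
    coeffBB (n + 1) k t =
      coeffBB n (k - 1) (qq * t) + tauB k t * coeffBB n (k + 1) (qq * t) := by
  rcases Nat.even_or_odd' n with ⟨m, rfl | rfl⟩ <;> rcases Nat.even_or_odd' k with ⟨j, rfl | rfl⟩
  · rw [coeffBB_of_parity (by omega), coeffBB_of_parity (by omega), coeffBB_of_parity (by omega)]
    simp
  · have := coeffBB_succ_odd ht m j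
    push_cast
    rwa [show 2 * (j : ℤ) + 1 - 1 = 2 * j by ring, show 2 * (j : ℤ) + 1 + 1 = 2 * j + 2 by ring]
  · have := coeffBB_succ_even ht m j
    push_cast
    rwa [show 2 * (m : ℤ) + 1 + 1 = 2 * m + 2 by ring]
  · rw [coeffBB_of_parity (by omega), coeffBB_of_parity (by omega), coeffBB_of_parity (by omega)]
    simp

lemma pow_eq_sum_genL_of_isGeneric (n : ℕ) : ∀ {t : F2}, IsGeneric t →
    (Polynomial.X : F2[X]) ^ n =
      ∑ k ∈ range (n + 1), Polynomial.C (coeffBB n k t) * genL k t := by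
  induction n with
  | zero =>
    intro t _
    simp [genL, coeffBB, qbinomF]
  | succ n ih =>
    intro t ht
    have hlow : ∑ k ∈ range (n + 2), Polynomial.C (coeffBB n ((k : ℤ) - 1) (qq * t)) * genL k t =
        ∑ k ∈ range (n + 1), Polynomial.C (coeffBB n k (qq * t)) * genL (k + 1) t := by
      rw [sum_range_succ', coeffBB_of_neg _ (by simp)]
      simp
    have hhigh : ∑ k ∈ range (n + 2),
        Polynomial.C (tauB k t * coeffBB n ((k : ℤ) + 1) (qq * t)) * genL k t =
        ∑ k ∈ range n, Polynomial.C (tauB k t * coeffBB n ((k : ℤ) + 1) (qq * t)) * genL k t := by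
      rw [sum_range_succ, sum_range_succ, coeffBB_of_lt (by omega), coeffBB_of_lt (by omega)]
      simp
    push_cast
    simp only [coeffBB_succ ht, map_add, add_mul, sum_add_distrib]
    rw [hlow, hhigh, pow_succ', ih ht.qq_mul, sum_range_succ', sum_range_succ', mul_add, mul_sum,
      add_right_comm, ← sum_add_distrib]
    congr 1
    · refine sum_congr rfl fun k _ => ?_
      rw [genL, map_mul]
      push_cast
      ring
    · simp only [genL, mul_one, Nat.cast_zero]
      ring

lemma coeffBB_zero_right (n : ℕ) : coeffBB (2 * n) 0 tt = typeB n := by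
  have h := coeffBB_even n 0 tt
  simp only [Nat.cast_zero, mul_zero] at h
  rw [h, laurentEval_eq_sum_range n fun i hi => evenTerm_eq_zero (Int.natCast_nonneg n) 0 hi, typeB]
  refine sum_congr rfl fun i _ => ?_
  rw [evenTerm, add_zero, show (i : ℤ) * i = ((i ^ 2 : ℕ) : ℤ) by push_cast; ring,
    zpow_natCast]
  ring

/-- `x^n = ∑_{k=0}^{n} b(n,k,t,q) L_k(x,t,q)` in `ℚ(q,t)[x]`, with
`b(2n,0,t,q) = M_n(t,q)`, and hence any `ℚ(q,t)`-linear functional `M` with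
`M(L_k(x,t,q)) = [k=0]` has moments `M(x^{2n}) = M_n(t,q)`. -/
theorem pow_eq_sum_genL :
    (∀ n : ℕ, (Polynomial.X : Polynomial F2) ^ n =
      ∑ k ∈ Finset.range (n + 1), Polynomial.C (coeffBB n k tt) * genL k tt) ∧
    (∀ n : ℕ, coeffBB (2 * n) 0 tt = typeB n) ∧
    (∀ M : Polynomial F2 →ₗ[F2] F2,
      (∀ k : ℕ, M (genL k tt) = if k = 0 then 1 else 0) →
      ∀ n : ℕ, M ((Polynomial.X : Polynomial F2) ^ (2 * n)) = typeB n) := by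
  refine ⟨fun n => pow_eq_sum_genL_of_isGeneric n isGeneric_tt, coeffBB_zero_right,
    fun M hM n => ?_⟩
  rw [pow_eq_sum_genL_of_isGeneric (2 * n) isGeneric_tt, map_sum, sum_eq_single 0]
  · rw [← smul_eq_C_mul, map_smul, hM]
    simpa using coeffBB_zero_right n
  · intro k _ hk
    rw [← smul_eq_C_mul, map_smul, hM, if_neg hk, smul_zero]
  · simp
end
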